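/- arXiv:1110.3653 — 2 statements merged into one kernel-verified Lean document; each statement's English description precedes it below -/
import Mathlib

section
/- Let A ⊆ B ⊆ ℕ^m be positive affine semigroups with C(A) = C(B). Then the quotient group G(B)/G(A) is finite, where G(X) denotes the subgroup of ℤ^m generated by X. -/
open Pointwise

noncomputable section

/-- Coordinatewise cast `ℕ^m → ℚ^m`. -/
def natCastQ {m : ℕ} (x : Fin m → ℕ) : Fin m → ℚ := fun i => (x i : ℚ)

/-- Coordinatewise cast `ℕ^m → ℤ^m`. -/
def natCastZ {m : ℕ} (x : Fin m → ℕ) : Fin m → ℤ := fun i => (x i : ℤ)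

/-- Coordinatewise cast `ℤ^m → ℚ^m`. -/
def intCastQ {m : ℕ} (x : Fin m → ℤ) : Fin m → ℚ := fun i => (x i : ℚ)

/-- The rational convex cone spanned by a subset of `ℕ^m` inside `ℚ^m`. -/
def ratCone {m : ℕ} (X : Set (Fin m → ℕ)) : Set (Fin m → ℚ) :=
  {y | ∃ (k : ℕ) (q : Fin k → ℚ) (x : Fin k → (Fin m → ℕ)),
    (∀ i, 0 ≤ q i) ∧ (∀ i, x i ∈ X) ∧ y = ∑ i, q i • natCastQ (x i)}

/-- `B_A = {x ∈ B : x ∉ B + (A ∖ {0})}`. -/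
def BA {m : ℕ} (A B : AddSubmonoid (Fin m → ℕ)) : Set (Fin m → ℕ) :=
  {x | x ∈ B ∧ x ∉ (B : Set (Fin m → ℕ)) + ((A : Set (Fin m → ℕ)) \ {0})}

/-- The subgroup of `ℤ^m` generated by a subset of `ℕ^m`. -/
def grpZ {m : ℕ} (X : Set (Fin m → ℕ)) : AddSubgroup (Fin m → ℤ) :=
  AddSubgroup.closure (natCastZ '' X)

theorem exists_nsmul_natCastZ_mem_grpZ {m : ℕ} {X : Set (Fin m → ℕ)} {b : Fin m → ℕ}
    (hb : natCastQ b ∈ ratCone X) : ∃ n : ℕ, 0 < n ∧ n • natCastZ b ∈ grpZ X := by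
  obtain ⟨k, q, x, -, hx, hy⟩ := hb
  refine ⟨∏ i, (q i).den, Finset.prod_pos fun i _ => (q i).den_pos, ?_⟩
  have hint : ∀ i, ∃ z : ℤ, (z : ℚ) = ((∏ j, (q j).den : ℕ) : ℚ) * q i := by
    intro i
    obtain ⟨d, hd⟩ := Finset.dvd_prod_of_mem (fun j => (q j).den) (Finset.mem_univ i)
    refine ⟨d * (q i).num, ?_⟩
    rw [hd]
    push_cast
    rw [← Rat.mul_den_eq_num (q i)]
    ring
  choose z hz using hint
  have hsum : (∏ i, (q i).den) • natCastZ b = ∑ i, z i • natCastZ (x i) := by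
    ext j
    have hj := congrFun hy j
    simp only [natCastQ, Finset.sum_apply, Pi.smul_apply, smul_eq_mul] at hj
    simp only [natCastZ, Finset.sum_apply, Pi.smul_apply, smul_eq_mul, nsmul_eq_mul]
    have key : (((∏ i, (q i).den : ℕ) : ℚ)) * (b j : ℚ) = ∑ i, (z i : ℚ) * (x i j : ℚ) := by
      rw [hj, Finset.mul_sum]
      exact Finset.sum_congr rfl fun i _ => by rw [hz, mul_assoc]
    exact_mod_cast key
  rw [hsum]
  exact sum_mem fun i _ => zsmul_mem (AddSubgroup.subset_closure (Set.mem_image_of_mem natCastZ (hx i))) _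

theorem exists_nsmul_mem_of_mem_closure {G : Type*} [AddCommGroup G] {S : Set G}
    {H : AddSubgroup G} (hS : ∀ s ∈ S, ∃ n : ℕ, 0 < n ∧ n • s ∈ H) {g : G}
    (hg : g ∈ AddSubgroup.closure S) : ∃ n : ℕ, 0 < n ∧ n • g ∈ H := by
  induction hg using AddSubgroup.closure_induction with
  | mem s hs => exact hS s hs
  | zero => exact ⟨1, one_pos, by simp⟩
  | add a b _ _ iha ihb =>
    obtain ⟨n, hn, hna⟩ := iha
    obtain ⟨k, hk, hkb⟩ := ihb
    refine ⟨n * k, Nat.mul_pos hn hk, ?_⟩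
    rw [nsmul_add, mul_nsmul, mul_nsmul']
    exact add_mem (nsmul_mem hna k) (nsmul_mem hkb n)
  | neg a _ iha =>
    obtain ⟨n, hn, hna⟩ := iha
    exact ⟨n, hn, by simpa using hna⟩

theorem natCastQ_mem_ratCone {m : ℕ} {X : Set (Fin m → ℕ)} {x : Fin m → ℕ} (hx : x ∈ X) :
    natCastQ x ∈ ratCone X :=
  ⟨1, fun _ => 1, fun _ => x, fun _ => zero_le_one, fun _ => hx, by simp⟩

/-- For positive affine semigroups `A ⊆ B ⊆ ℕ^m` with `C(A) = C(B)`, the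
quotient group `G(B)/G(A)` is finite. -/
theorem quotient_group_finite {m : ℕ} (A B : AddSubmonoid (Fin m → ℕ)) (hAB : A ≤ B)
    (hA : A.FG) (hB : B.FG)
    (hC : ratCone (A : Set (Fin m → ℕ)) = ratCone (B : Set (Fin m → ℕ))) :
    Finite (grpZ (B : Set (Fin m → ℕ)) ⧸
      (grpZ (A : Set (Fin m → ℕ))).addSubgroupOf (grpZ (B : Set (Fin m → ℕ)))) := by
  have : AddGroup.FG (grpZ (B : Set (Fin m → ℕ))) := by
    rw [← Module.Finite.iff_addGroup_fg]
    exact Module.Finite.of_fg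
      (IsNoetherian.noetherian (AddSubgroup.toIntSubmodule (grpZ (B : Set (Fin m → ℕ)))))
  refine AddCommGroup.finite_of_fg_isAddTorsion _ fun y => ?_
  induction y using QuotientAddGroup.induction_on with
  | H g =>
  obtain ⟨n, hn, hng⟩ := exists_nsmul_mem_of_mem_closure
    (H := grpZ (A : Set (Fin m → ℕ))) (by
      rintro _ ⟨b, hb, rfl⟩
      exact exists_nsmul_natCastZ_mem_grpZ (hC ▸ natCastQ_mem_ratCone hb)) g.2
  refine isOfFinAddOrder_iff_nsmul_eq_zero.2 ⟨n, hn, ?_⟩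
  rw [← QuotientAddGroup.mk_nsmul, QuotientAddGroup.eq_zero_iff]
  exact hng
end
end

section
/- Let B ⊆ ℕ^m be a positive affine semigroup, let e₁, …, e_d ∈ B be linearly independent over ℚ with C({e₁,…,e_d}) = C(B), let A be the submonoid of B generated by e₁,…,e_d, let K be a field, and set B_A := {x ∈ B : x ∉ B + (A ∖ {0})}. Then the integral domain K[B] is normal (i.e., integrally closed in its field of fractions) if and only if for every x ∈ B_A there exist rational numbers λ₁, …, λ_d with 0 ≤ λ_i < 1 for all i such that x = λ₁e₁ + ⋯ + λ_d e_d in ℚ^m. -/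
open Pointwise

noncomputable section

/-- If `R → S` is an injective ring homomorphism with an `R`-linear retraction `ρ`, then `R` is
integrally closed as soon as `S` is. -/
theorem IsIntegrallyClosed.of_retraction {R S : Type*} [CommRing R] [CommRing S] [IsDomain R]
    [IsDomain S] [IsIntegrallyClosed S] (f : R →+* S) (hf : Function.Injective f) (ρ : S → R)
    (hρ : ∀ r s, ρ (f r * s) = r * ρ s) (hρf : ∀ r, ρ (f r) = r) : IsIntegrallyClosed R := by
  have hinj : Function.Injective ((algebraMap S (FractionRing S)).comp f) :=
    (IsFractionRing.injective S (FractionRing S)).comp hf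
  let g : FractionRing R →+* FractionRing S := IsFractionRing.lift hinj
  have hg (r : R) : g (algebraMap R _ r) = algebraMap S _ (f r) :=
    IsFractionRing.lift_algebraMap hinj r
  refine (isIntegrallyClosed_iff (FractionRing R)).2 fun {x} hx => ?_
  have hgx : IsIntegral S (g x) := hx.map_of_comp_eq f g (RingHom.ext fun r => (hg r).symm)
  obtain ⟨s, hs⟩ := IsIntegrallyClosed.algebraMap_eq_of_integral hgx
  obtain ⟨a, b, hb, rfl⟩ := IsFractionRing.div_surjective (A := R) x
  have hb0 : algebraMap R (FractionRing R) b ≠ 0 :=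
    IsFractionRing.to_map_ne_zero_of_mem_nonZeroDivisors hb
  have hfs : f b * s = f a := by
    apply IsFractionRing.injective S (FractionRing S)
    rw [map_mul, hs, map_div₀, ← hg, ← hg, mul_div_cancel₀]
    exact (map_ne_zero g).2 hb0
  refine ⟨ρ s, ?_⟩
  rw [eq_div_iff hb0, mul_comm, ← map_mul, ← hρ, hfs, hρf]

/-- Restricting coefficients along a full embedding of commutative monoids is linear over the
smaller monoid algebra. -/
theorem AddMonoidAlgebra.comapDomain_mapDomain_mul {R M P : Type*} [CommSemiring R]
    [AddCommMonoid M] [AddCommMonoid P] (φ : M →+ P) (hφ : Function.Injective φ)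
    (hfull : ∀ x y v, φ y = φ x + v → v ∈ Set.range φ)
    (r : AddMonoidAlgebra R M) (s : AddMonoidAlgebra R P) :
    comapDomain φ hφ (mapDomain φ r * s) = r * comapDomain φ hφ s := by
  have hzero {p : P} {a : R} (hp : p ∉ Set.range φ) : comapDomain φ hφ (single p a) = 0 := by
    ext
    simp_all
  induction r using AddMonoidAlgebra.induction_linear with
  | zero => simp
  | add r₁ r₂ h₁ h₂ => simp [mapDomain_add, add_mul, h₁, h₂]
  | single m k =>
    induction s using AddMonoidAlgebra.induction_linear with
    | zero => simp
    | add s₁ s₂ h₁ h₂ => simp only [mul_add, comapDomain_add, h₁, h₂]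
    | single v l =>
      rw [mapDomain_single, single_mul_single]
      by_cases hv : v ∈ Set.range φ
      · obtain ⟨n, rfl⟩ := hv
        rw [← map_add, comapDomain_single_map, comapDomain_single_map, single_mul_single]
      · rw [hzero hv, hzero fun ⟨y, hy⟩ => hv (hfull m y v hy), mul_zero]

/-- The monoid algebra of a full submonoid inherits integral closedness. -/
theorem AddMonoidAlgebra.isIntegrallyClosed_of_full {R M P : Type*} [CommRing R]
    [AddCommMonoid M] [AddCommMonoid P] [IsDomain (AddMonoidAlgebra R P)]
    [IsIntegrallyClosed (AddMonoidAlgebra R P)] (φ : M →+ P) (hφ : Function.Injective φ)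
    (hfull : ∀ x y v, φ y = φ x + v → v ∈ Set.range φ) :
    IsIntegrallyClosed (AddMonoidAlgebra R M) := by
  have hf : Function.Injective (mapDomainRingHom R φ) := mapDomain_injective hφ
  have := hf.isDomain (mapDomainRingHom R φ)
  refine IsIntegrallyClosed.of_retraction (mapDomainRingHom R φ) hf (comapDomain φ hφ)
    (comapDomain_mapDomain_mul φ hφ hfull) fun r => ?_
  ext m
  exact DFunLike.congr_fun (Finsupp.comapDomain_mapDomain φ hφ r.coeff) m

/-- In an integrally closed monoid algebra domain, divisibility of multiples by a common positive
factor descends to the monoid. -/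
theorem AddMonoidAlgebra.exists_add_of_nsmul_eq (K : Type*) [Field K] {M : Type*}
    [AddCommMonoid M] [IsDomain (AddMonoidAlgebra K M)] [IsIntegrallyClosed (AddMonoidAlgebra K M)]
    {N : ℕ} (hN : N ≠ 0) {x y b : M} (h : N • x = N • y + b) : ∃ c, x = y + c := by
  have hdvd : (AddMonoidAlgebra.single y 1 : AddMonoidAlgebra K M) ^ N ∣
      (AddMonoidAlgebra.single x 1) ^ N := by
    refine ⟨AddMonoidAlgebra.single b 1, ?_⟩
    simp [AddMonoidAlgebra.single_pow, AddMonoidAlgebra.single_mul_single, h]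
  obtain ⟨s, hs⟩ := (IsIntegrallyClosed.pow_dvd_pow_iff hN).1 hdvd
  by_contra! hne
  have := congrArg (fun p => p.coeff x) hs
  simp [AddMonoidAlgebra.coeff_single_mul_of_forall_add_ne _ _ fun d => (hne d).symm] at this

theorem natCastQ_injective {m : ℕ} : Function.Injective (natCastQ (m := m)) := fun _ _ h =>
  funext fun i => Nat.cast_injective (congrFun h i)

theorem natCastQ_nsmul {m : ℕ} (n : ℕ) (x : Fin m → ℕ) :
    natCastQ (n • x) = (n : ℚ) • natCastQ x := by
  ext
  simp [natCastQ]

theorem natCastQ_sum_nsmul {m d : ℕ} (n : Fin d → ℕ) (e : Fin d → (Fin m → ℕ)) :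
    natCastQ (∑ i, n i • e i) = ∑ i, (n i : ℚ) • natCastQ (e i) := by
  ext
  simp [natCastQ]

/-- An element of the cone spanned by a finite family is a nonnegative combination of it. -/
theorem exists_nonneg_of_mem_ratCone_range {m d : ℕ} {e : Fin d → (Fin m → ℕ)} {y : Fin m → ℚ}
    (hy : y ∈ ratCone (Set.range e)) :
    ∃ lam : Fin d → ℚ, (∀ i, 0 ≤ lam i) ∧ y = ∑ i, lam i • natCastQ (e i) := by
  obtain ⟨k, q, x, hq, hx, rfl⟩ := hy
  choose f hf using hx
  refine ⟨fun i => ∑ j with f j = i, q j, fun i => Finset.sum_nonneg fun j _ => hq j, ?_⟩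
  rw [← Finset.sum_fiberwise _ f]
  refine Finset.sum_congr rfl fun i _ => ?_
  rw [Finset.sum_smul]
  refine Finset.sum_congr rfl fun j hj => ?_
  rw [← hf j, (Finset.mem_filter.1 hj).2]

/-- Every lattice point of the cone over a finite family has a positive multiple in the monoid
generated by that family. -/
theorem exists_nsmul_mem_closure_of_mem_ratCone {m d : ℕ} {e : Fin d → (Fin m → ℕ)}
    {x : Fin m → ℕ} (hx : natCastQ x ∈ ratCone (Set.range e)) :
    ∃ N : ℕ, N ≠ 0 ∧ N • x ∈ AddSubmonoid.closure (Set.range e) := by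
  obtain ⟨lam, hlam, hsum⟩ := exists_nonneg_of_mem_ratCone_range hx
  let N := ∏ i, (lam i).den
  have hN (i : Fin d) : ∃ n : ℕ, (N : ℚ) * lam i = n := by
    obtain ⟨k, hk⟩ : (lam i).den ∣ N := Finset.dvd_prod_of_mem _ (Finset.mem_univ i)
    refine ⟨k * (lam i).num.toNat, ?_⟩
    have h1 : (((lam i).num.toNat : ℤ) : ℚ) = (lam i).num := by
      rw [Int.toNat_of_nonneg (Rat.num_nonneg.2 (hlam i))]
    push_cast at h1 ⊢
    rw [hk, h1, ← Rat.mul_den_eq_num]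
    push_cast
    ring
  choose n hn using hN
  refine ⟨N, Finset.prod_ne_zero_iff.2 fun i _ => (lam i).den_ne_zero, ?_⟩
  refine AddSubmonoid.mem_closure_range_iff_of_fintype.2 ⟨n, natCastQ_injective ?_⟩
  rw [natCastQ_sum_nsmul, natCastQ_nsmul, hsum, Finset.smul_sum]
  simp [smul_smul, hn]

/-- If every element of a finitely generated commutative monoid has a positive multiple in a given
submonoid, then a single positive integer works for all elements. -/
theorem AddSubmonoid.FG.exists_nsmul_mem {M : Type*} [AddCommMonoid M] {A B : AddSubmonoid M}
    (hB : B.FG) (h : ∀ x ∈ B, ∃ N : ℕ, N ≠ 0 ∧ N • x ∈ A) :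
    ∃ N : ℕ, N ≠ 0 ∧ ∀ x ∈ B, N • x ∈ A := by
  obtain ⟨S, rfl⟩ := hB
  choose! f hf0 hf using h
  refine ⟨∏ s ∈ S, f s, Finset.prod_ne_zero_iff.2 fun s hs => hf0 s (subset_closure hs), ?_⟩
  suffices closure (S : Set M) ≤ A.comap (nsmulAddMonoidHom (∏ s ∈ S, f s)) from this
  refine closure_le.2 fun s hs => ?_
  obtain ⟨k, hk⟩ := Finset.dvd_prod_of_mem f hs
  change (∏ s ∈ S, f s) • s ∈ A
  rw [hk, mul_comm, mul_smul]
  exact A.nsmul_mem (hf s (subset_closure hs)) k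

/-- Every element of `B` is the sum of an element of `B_A` and an element of `A`. -/
theorem exists_eq_BA_add {m : ℕ} {A B : AddSubmonoid (Fin m → ℕ)} (x : Fin m → ℕ) (hx : x ∈ B) :
    ∃ w ∈ BA A B, ∃ a ∈ A, x = w + a := by
  induction hs : ∑ i, x i using Nat.strong_induction_on generalizing x with
  | _ s ih =>
    by_cases hxA : x ∈ BA A B
    · exact ⟨x, hxA, 0, A.zero_mem, (add_zero x).symm⟩
    · obtain ⟨b, hb, a, ⟨ha, ha0⟩, rfl⟩ := not_not.1 fun h => hxA ⟨hx, h⟩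
      have hlt : ∑ i, b i < s := by
        obtain ⟨i, hi⟩ := Function.ne_iff.1 ha0
        rw [← hs]
        exact Finset.sum_lt_sum (fun j _ => Nat.le_add_right _ _)
          ⟨i, Finset.mem_univ i, Nat.lt_add_of_pos_right (Nat.pos_of_ne_zero hi)⟩
      obtain ⟨w, hw, a', ha', rfl⟩ := ih _ hlt b hb rfl
      exact ⟨w, hw, a' + a, A.add_mem ha' ha, add_assoc _ _ _⟩

theorem eq_of_sum_nsmul_eq {m d : ℕ} {e : Fin d → (Fin m → ℕ)}
    (hind : LinearIndependent ℚ (fun i => natCastQ (e i))) {n n' : Fin d → ℕ}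
    (h : ∑ i, n i • e i = ∑ i, n' i • e i) : n = n' := by
  have h' := congrArg natCastQ h
  rw [natCastQ_sum_nsmul, natCastQ_sum_nsmul] at h'
  exact funext fun i => Nat.cast_injective (Fintype.linearIndependent_iffₛ.1 hind _ _ h' i)

/-- After scaling by a suitable `N ≠ 0`, the elements of `B` have natural number coordinates with
respect to the linearly independent elements spanning the cone of `B`. -/
theorem exists_scaled_coordinates {m d : ℕ} {B : AddSubmonoid (Fin m → ℕ)} (hB : B.FG)
    {e : Fin d → (Fin m → ℕ)} (hind : LinearIndependent ℚ (fun i => natCastQ (e i)))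
    (hcone : ratCone (Set.range e) = ratCone (B : Set (Fin m → ℕ))) :
    ∃ (N : ℕ) (φ : B →+ (Fin d →₀ ℕ)), N ≠ 0 ∧ ∀ x, ∑ i, φ x i • e i = N • (x : Fin m → ℕ) := by
  obtain ⟨N, hN, h⟩ := hB.exists_nsmul_mem (A := AddSubmonoid.closure (Set.range e)) fun x hx =>
    exists_nsmul_mem_closure_of_mem_ratCone
      (hcone ▸ ⟨1, fun _ => 1, fun _ => x, by simp, by simpa using hx, by simp⟩)
  have h' (x : B) : ∃ n : Fin d →₀ ℕ, ∑ i, n i • e i = N • (x : Fin m → ℕ) := by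
    obtain ⟨n, hn⟩ := AddSubmonoid.mem_closure_range_iff_of_fintype.1 (h x x.2)
    exact ⟨Finsupp.equivFunOnFinite.symm n, hn.symm⟩
  choose φ hφ using h'
  refine ⟨N, ⟨⟨φ, ?_⟩, ?_⟩, hN, hφ⟩
  · refine DFunLike.coe_injective (eq_of_sum_nsmul_eq hind ?_)
    exact (hφ 0).trans (by simp)
  · intro x y
    refine DFunLike.coe_injective (eq_of_sum_nsmul_eq hind ?_)
    simp only [Finsupp.add_apply, add_smul, Finset.sum_add_distrib]
    rw [hφ, hφ, hφ, B.coe_add, smul_add]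

/-- The half-open box condition in terms of scaled coordinates. -/
theorem exists_box_iff_lt {m d : ℕ} {e : Fin d → (Fin m → ℕ)}
    (hind : LinearIndependent ℚ (fun i => natCastQ (e i))) {N : ℕ} (hN : N ≠ 0)
    {n : Fin d → ℕ} {x : Fin m → ℕ} (h : ∑ i, n i • e i = N • x) :
    (∃ lam : Fin d → ℚ, (∀ i, 0 ≤ lam i ∧ lam i < 1) ∧ natCastQ x = ∑ i, lam i • natCastQ (e i)) ↔
      ∀ i, n i < N := by
  have hN' : (0 : ℚ) < N := by positivity
  have hQ := congrArg natCastQ h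
  rw [natCastQ_sum_nsmul, natCastQ_nsmul] at hQ
  constructor
  · rintro ⟨lam, hlam, hx⟩ i
    rw [hx, Finset.smul_sum] at hQ
    simp only [smul_smul] at hQ
    have hi : (n i : ℚ) = N * lam i := Fintype.linearIndependent_iffₛ.1 hind _ _ hQ i
    have : (n i : ℚ) < N := by
      rw [hi]
      exact mul_lt_of_lt_one_right hN' (hlam i).2
    exact_mod_cast this
  · intro hn
    refine ⟨fun i => n i / N, fun i => ⟨by positivity, ?_⟩, ?_⟩
    · rw [div_lt_one hN']
      exact_mod_cast hn i
    · simp only [div_eq_inv_mul, mul_smul]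
      rw [← Finset.smul_sum, hQ, inv_smul_smul₀ hN'.ne']

/-- For a simplicial semigroup `B` with `A` generated by linearly independent
elements `e₁,…,e_d` of `B` spanning the same cone, the domain `K[B]` is normal (integrally
closed in its fraction field) if and only if every `x ∈ B_A` is a rational combination
`x = Σ λᵢ eᵢ` with `0 ≤ λᵢ < 1`. -/
theorem normal_iff_BA_in_halfopen_box {m d : ℕ} (K : Type*) [Field K]
    (B : AddSubmonoid (Fin m → ℕ)) (hB : B.FG)
    (e : Fin d → (Fin m → ℕ)) (he : ∀ i, e i ∈ B)
    (hind : LinearIndependent ℚ (fun i => natCastQ (e i)))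
    (hcone : ratCone (Set.range e) = ratCone (B : Set (Fin m → ℕ)))
    (A : AddSubmonoid (Fin m → ℕ)) (hA : A = AddSubmonoid.closure (Set.range e))
    (hAB : A ≤ B) :
    IsIntegrallyClosed (AddMonoidAlgebra K B) ↔
    ∀ x ∈ BA A B, ∃ lam : Fin d → ℚ, (∀ i, 0 ≤ lam i ∧ lam i < 1) ∧
      natCastQ x = ∑ i, lam i • natCastQ (e i) := by
  subst hA
  have hdom : IsDomain (AddMonoidAlgebra K B) := by
    have : UniqueSums B :=
      UniqueSums.of_injective_addHom B.subtype.toAddHom Subtype.val_injective inferInstance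
    infer_instance
  obtain ⟨N, φ, hN, hφ⟩ := exists_scaled_coordinates hB hind hcone
  have hbox : (∀ x ∈ BA (AddSubmonoid.closure (Set.range e)) B, ∃ lam : Fin d → ℚ,
      (∀ i, 0 ≤ lam i ∧ lam i < 1) ∧ natCastQ x = ∑ i, lam i • natCastQ (e i)) ↔
      ∀ x : B, (x : Fin m → ℕ) ∈ BA (AddSubmonoid.closure (Set.range e)) B → ∀ i, φ x i < N :=
    ⟨fun h x hx => (exists_box_iff_lt hind hN (hφ x)).1 (h x hx),
      fun h x hx => (exists_box_iff_lt hind hN (hφ ⟨x, hx.1⟩)).2 (h ⟨x, hx.1⟩ hx)⟩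
  rw [hbox]
  have hAB' (n : Fin d → ℕ) : ∑ i, n i • e i ∈ B := B.sum_mem fun i _ => B.nsmul_mem (he i) _
  constructor
  · intro hK x hx j
    by_contra! hj
    have hx' : N • x = N • (⟨e j, he j⟩ : B) + ⟨_, hAB' (⇑(φ x) - Pi.single j N)⟩ := by
      apply Subtype.ext
      have hsingle : N • e j = ∑ i, (Pi.single j N : Fin d → ℕ) i • e i := by
        simp [Pi.single_apply, ite_smul]
      change N • (x : Fin m → ℕ) = N • e j + ∑ i, (⇑(φ x) - (Pi.single j N : Fin d → ℕ)) i • e i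
      rw [← hφ, hsingle, ← Finset.sum_add_distrib]
      refine Finset.sum_congr rfl fun i _ => ?_
      rw [← add_smul, Pi.sub_apply, add_tsub_cancel_of_le]
      rw [Pi.single_apply]
      split_ifs with hij
      · exact hij ▸ hj
      · exact Nat.zero_le _
    obtain ⟨c, hc⟩ := AddMonoidAlgebra.exists_add_of_nsmul_eq K hN hx'
    refine hx.2 ⟨c, c.2, e j, ⟨AddSubmonoid.subset_closure ⟨j, rfl⟩, fun h0 => ?_⟩, ?_⟩
    · refine hind.ne_zero j ?_
      ext i
      simpa [natCastQ] using congrFun h0 i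
    · rw [hc, add_comm]
      rfl
  · intro h
    have hinj : Function.Injective φ := fun x y hxy => by
      have := (hφ x).symm.trans (hxy ▸ hφ y)
      exact Subtype.ext (nsmul_right_injective hN this)
    have : IsIntegrallyClosed (AddMonoidAlgebra K (Fin d →₀ ℕ)) :=
      inferInstanceAs (IsIntegrallyClosed (MvPolynomial (Fin d) K))
    refine AddMonoidAlgebra.isIntegrallyClosed_of_full φ hinj fun x y v hv => ?_
    obtain ⟨w, hw, a, ha, hwa⟩ := exists_eq_BA_add (A := AddSubmonoid.closure (Set.range e)) _
      (y + (N - 1) • x).2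
    obtain ⟨c, rfl⟩ := AddSubmonoid.mem_closure_range_iff_of_fintype.1 ha
    lift w to B using hw.1
    have hsum (i : Fin d) : φ y i + (N - 1) * φ x i = φ w i + N * c i := by
      have : (fun i => φ (y + (N - 1) • x) i) = fun i => φ w i + N * c i := by
        refine eq_of_sum_nsmul_eq hind ?_
        simp only [add_smul, Finset.sum_add_distrib, mul_smul, ← Finset.smul_sum, hφ]
        rw [hwa, smul_add]
      simpa using congrFun this i
    have hsum' (i : Fin d) : v i + N * φ x i = φ w i + N * c i := by
      rw [← hsum i, hv, Finsupp.add_apply]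
      obtain ⟨k, rfl⟩ := Nat.exists_eq_succ_of_ne_zero hN
      simp
      ring
    have hle (i : Fin d) : φ x i ≤ c i := by
      by_contra! hlt
      have h1 := h w hw i
      have h2 : N * (c i + 1) ≤ N * φ x i := Nat.mul_le_mul_left N hlt
      have h3 := hsum' i
      rw [mul_add] at h2
      omega
    refine ⟨w + ⟨_, hAB' fun i => c i - φ x i⟩, DFunLike.coe_injective
      (eq_of_sum_nsmul_eq hind ?_)⟩
    rw [hφ]
    have hv' (i : Fin d) : v i = φ w i + N * (c i - φ x i) := by
      have h1 := hsum' i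
      have h2 := Nat.mul_le_mul_left N (hle i)
      rw [Nat.mul_sub]
      omega
    simp only [hv', add_smul, Finset.sum_add_distrib, mul_smul, ← Finset.smul_sum, hφ]
    simp
end
end
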